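/- Let σ be continuously differentiable and positive on an open neighborhood of the closed unit square, and let (u, U) be a classical CEM solution for σ with impedances z₀, z₁ > 0 and currents I₀, I₁ satisfying I₀ + I₁ = 0. Then (u, U) is a global minimizer of the CEM energy functional: F_σ(u,U) ≤ F_σ(v,V) for every v continuously differentiable on an open neighborhood of the closed square and every V = (V₀,V₁) ∈ ℝ² with V₀ + V₁ = 0; moreover, equality F_σ(v,V) = F_σ(u,U) holds only if v = u on the closed square and V = U. -/

import Mathlib

open MeasureTheory Set

/-- Partial derivative in the first (x) variable. -/
noncomputable def pdx (u : ℝ × ℝ → ℝ) (p : ℝ × ℝ) : ℝ :=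
  deriv (fun t => u (t, p.2)) p.1

/-- Partial derivative in the second (y) variable. -/
noncomputable def pdy (u : ℝ × ℝ → ℝ) (p : ℝ × ℝ) : ℝ :=
  deriv (fun t => u (p.1, t)) p.2

/-- Euclidean norm of the gradient `|∇u|`. -/
noncomputable def gradNorm (u : ℝ × ℝ → ℝ) (p : ℝ × ℝ) : ℝ :=
  Real.sqrt ((pdx u p) ^ 2 + (pdy u p) ^ 2)

/-- The closed unit square `[0,1] × [0,1]`. -/
def SQ : Set (ℝ × ℝ) := Icc (0 : ℝ) 1 ×ˢ Icc (0 : ℝ) 1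

/-- The open unit square `(0,1) × (0,1)`. -/
def SQo : Set (ℝ × ℝ) := Ioo (0 : ℝ) 1 ×ˢ Ioo (0 : ℝ) 1

/-- `v` is continuously differentiable on an open neighborhood of the closed unit square. -/
def C1Nbhd (v : ℝ × ℝ → ℝ) : Prop :=
  ∃ W : Set (ℝ × ℝ), IsOpen W ∧ SQ ⊆ W ∧ ContDiffOn ℝ 1 v W

/-- A classical solution `(u, (U₀, U₁))` of the Complete Electrode Model on the unit square
for the conductivity `σ`, constant impedances `z₀, z₁` (bottom/top electrodes) and
input currents `I₀, I₁`. -/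
structure IsCEMSolution (σ u : ℝ × ℝ → ℝ) (U₀ U₁ z₀ z₁ I₀ I₁ : ℝ) : Prop where
  smooth : ∃ W : Set (ℝ × ℝ), IsOpen W ∧ SQ ⊆ W ∧ ContDiffOn ℝ 2 u W
  ground : U₀ + U₁ = 0
  pde : ∀ p ∈ SQo,
    pdx (fun q => σ q * pdx u q) p + pdy (fun q => σ q * pdy u q) p = 0
  robin_bot : ∀ x ∈ Icc (0 : ℝ) 1, u (x, 0) - z₀ * σ (x, 0) * pdy u (x, 0) = U₀
  robin_top : ∀ x ∈ Icc (0 : ℝ) 1, u (x, 1) + z₁ * σ (x, 1) * pdy u (x, 1) = U₁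
  flux_bot : (∫ x in (0 : ℝ)..1, -(σ (x, 0) * pdy u (x, 0))) = I₀
  flux_top : (∫ x in (0 : ℝ)..1, σ (x, 1) * pdy u (x, 1)) = I₁
  noflux_left : ∀ y ∈ Icc (0 : ℝ) 1, pdx u (0, y) = 0
  noflux_right : ∀ y ∈ Icc (0 : ℝ) 1, pdx u (1, y) = 0

/-- The weighted least-gradient functional `G_a` with CEM boundary terms. -/
noncomputable def Gfun (a : ℝ × ℝ → ℝ) (z₀ z₁ I₀ I₁ : ℝ) (v : ℝ × ℝ → ℝ)
    (V₀ V₁ : ℝ) : ℝ :=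
  (∫ p in SQo, a p * gradNorm v p)
    + (1 / (2 * z₀)) * (∫ x in (0 : ℝ)..1, (v (x, 0) - V₀) ^ 2)
    + (1 / (2 * z₁)) * (∫ x in (0 : ℝ)..1, (v (x, 1) - V₁) ^ 2)
    - I₀ * V₀ - I₁ * V₁

/-- The CEM energy functional `F_σ`. -/
noncomputable def Ffun (σ : ℝ × ℝ → ℝ) (z₀ z₁ I₀ I₁ : ℝ) (v : ℝ × ℝ → ℝ)
    (V₀ V₁ : ℝ) : ℝ :=
  (1 / 2) * (∫ p in SQo, σ p * ((pdx v p) ^ 2 + (pdy v p) ^ 2))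
    + (1 / (2 * z₀)) * (∫ x in (0 : ℝ)..1, (v (x, 0) - V₀) ^ 2)
    + (1 / (2 * z₁)) * (∫ x in (0 : ℝ)..1, (v (x, 1) - V₁) ^ 2)
    - I₀ * V₀ - I₁ * V₁

theorem pdx_eq_fderiv {f : ℝ × ℝ → ℝ} {p : ℝ × ℝ} (hf : DifferentiableAt ℝ f p) :
    pdx f p = fderiv ℝ f p (1, 0) := by
  have h : HasDerivAt (fun t : ℝ => (t, p.2)) ((1 : ℝ), (0 : ℝ)) p.1 :=
    (hasDerivAt_id p.1).prodMk (hasDerivAt_const p.1 p.2)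
  exact (HasFDerivAt.comp_hasDerivAt p.1 (f := fun t : ℝ => (t, p.2)) hf.hasFDerivAt h).deriv

theorem hasDerivAt_vertical {f : ℝ × ℝ → ℝ} {p : ℝ × ℝ} (hf : DifferentiableAt ℝ f p) :
    HasDerivAt (fun t => f (p.1, t)) (fderiv ℝ f p (0, 1)) p.2 := by
  have h : HasDerivAt (fun t : ℝ => (p.1, t)) ((0 : ℝ), (1 : ℝ)) p.2 :=
    (hasDerivAt_const p.2 p.1).prodMk (hasDerivAt_id p.2)
  exact HasFDerivAt.comp_hasDerivAt p.2 (f := fun t : ℝ => (p.1, t)) hf.hasFDerivAt h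

theorem pdy_eq_fderiv {f : ℝ × ℝ → ℝ} {p : ℝ × ℝ} (hf : DifferentiableAt ℝ f p) :
    pdy f p = fderiv ℝ f p (0, 1) :=
  (hasDerivAt_vertical hf).deriv

theorem ContDiffOn.differentiableAt_of_isOpen {f : ℝ × ℝ → ℝ} {W : Set (ℝ × ℝ)} {p : ℝ × ℝ}
    (hf : ContDiffOn ℝ 1 f W) (hW : IsOpen W) (hp : p ∈ W) : DifferentiableAt ℝ f p :=
  (hf.contDiffAt (hW.mem_nhds hp)).differentiableAt one_ne_zero

theorem ContDiffOn.pdx {f : ℝ × ℝ → ℝ} {W : Set (ℝ × ℝ)} {m n : WithTop ℕ∞}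
    (hf : ContDiffOn ℝ n f W) (hW : IsOpen W) (hmn : m + 1 ≤ n) : ContDiffOn ℝ m (pdx f) W :=
  ((hf.fderiv_of_isOpen hW hmn).clm_apply contDiffOn_const).congr fun _ hp =>
    pdx_eq_fderiv ((hf.of_le (le_trans le_add_self hmn)).differentiableAt_of_isOpen hW hp)

theorem ContDiffOn.pdy {f : ℝ × ℝ → ℝ} {W : Set (ℝ × ℝ)} {m n : WithTop ℕ∞}
    (hf : ContDiffOn ℝ n f W) (hW : IsOpen W) (hmn : m + 1 ≤ n) : ContDiffOn ℝ m (pdy f) W :=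
  ((hf.fderiv_of_isOpen hW hmn).clm_apply contDiffOn_const).congr fun _ hp =>
    pdy_eq_fderiv ((hf.of_le (le_trans le_add_self hmn)).differentiableAt_of_isOpen hW hp)

theorem pdx_mul {f g : ℝ × ℝ → ℝ} {p : ℝ × ℝ} (hf : DifferentiableAt ℝ f p)
    (hg : DifferentiableAt ℝ g p) :
    pdx (fun q => f q * g q) p = pdx f p * g p + f p * pdx g p := by
  rw [pdx_eq_fderiv (hf.fun_mul hg), pdx_eq_fderiv hf, pdx_eq_fderiv hg, fderiv_fun_mul hf hg]
  simp
  ring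

theorem pdy_mul {f g : ℝ × ℝ → ℝ} {p : ℝ × ℝ} (hf : DifferentiableAt ℝ f p)
    (hg : DifferentiableAt ℝ g p) :
    pdy (fun q => f q * g q) p = pdy f p * g p + f p * pdy g p := by
  rw [pdy_eq_fderiv (hf.fun_mul hg), pdy_eq_fderiv hf, pdy_eq_fderiv hg, fderiv_fun_mul hf hg]
  simp
  ring

theorem pdx_sub {f g : ℝ × ℝ → ℝ} {p : ℝ × ℝ} (hf : DifferentiableAt ℝ f p)
    (hg : DifferentiableAt ℝ g p) : pdx (fun q => f q - g q) p = pdx f p - pdx g p := by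
  rw [pdx_eq_fderiv (hf.fun_sub hg), pdx_eq_fderiv hf, pdx_eq_fderiv hg, fderiv_fun_sub hf hg]
  simp

theorem pdy_sub {f g : ℝ × ℝ → ℝ} {p : ℝ × ℝ} (hf : DifferentiableAt ℝ f p)
    (hg : DifferentiableAt ℝ g p) : pdy (fun q => f q - g q) p = pdy f p - pdy g p := by
  rw [pdy_eq_fderiv (hf.fun_sub hg), pdy_eq_fderiv hf, pdy_eq_fderiv hg, fderiv_fun_sub hf hg]
  simp

theorem SQ_eq_Icc : SQ = Icc ((0 : ℝ), (0 : ℝ)) (1, 1) := Icc_prod_Icc _ _ _ _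

theorem SQo_subset_SQ : SQo ⊆ SQ := prod_mono Ioo_subset_Icc_self Ioo_subset_Icc_self

theorem isOpen_SQo : IsOpen SQo := isOpen_Ioo.prod isOpen_Ioo

theorem isCompact_SQ : IsCompact SQ := isCompact_Icc.prod isCompact_Icc

theorem closure_SQo : closure SQo = SQ := by
  rw [SQo, SQ, closure_prod_eq, closure_Ioo zero_ne_one]

theorem SQo_ae_eq_SQ : SQo =ᵐ[volume] SQ :=
  Measure.set_prod_ae_eq Ioo_ae_eq_Icc Ioo_ae_eq_Icc

theorem ContinuousOn.integrableOn_SQo {f : ℝ × ℝ → ℝ} (hf : ContinuousOn f SQ) :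
    IntegrableOn f SQo :=
  (hf.integrableOn_compact isCompact_SQ).mono_set SQo_subset_SQ

/-- The divergence theorem on the unit square. -/
theorem integral_SQo_pdx_add_pdy {f g : ℝ × ℝ → ℝ} {W : Set (ℝ × ℝ)} (hW : IsOpen W)
    (hSW : SQ ⊆ W) (hf : ContDiffOn ℝ 1 f W) (hg : ContDiffOn ℝ 1 g W) :
    ∫ p in SQo, (pdx f p + pdy g p) =
      (∫ x in (0 : ℝ)..1, g (x, 1)) - (∫ x in (0 : ℝ)..1, g (x, 0))
        + (∫ y in (0 : ℝ)..1, f (1, y)) - ∫ y in (0 : ℝ)..1, f (0, y) := by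
  have hdf : ∀ p ∈ SQ, DifferentiableAt ℝ f p := fun p hp =>
    hf.differentiableAt_of_isOpen hW (hSW hp)
  have hdg : ∀ p ∈ SQ, DifferentiableAt ℝ g p := fun p hp =>
    hg.differentiableAt_of_isOpen hW (hSW hp)
  have heq : ∀ p ∈ SQ, pdx f p + pdy g p = fderiv ℝ f p (1, 0) + fderiv ℝ g p (0, 1) :=
    fun p hp => by rw [pdx_eq_fderiv (hdf p hp), pdy_eq_fderiv (hdg p hp)]
  have hcont : ContinuousOn (fun p => fderiv ℝ f p (1, 0) + fderiv ℝ g p (0, 1)) SQ :=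
    ((((hf.pdx (m := 0) hW (by simp)).continuousOn.add
      (hg.pdy (m := 0) hW (by simp)).continuousOn)).mono hSW).congr fun p hp => (heq p hp).symm
  have hmeas : MeasurableSet SQ := isCompact_SQ.measurableSet
  rw [setIntegral_congr_set SQo_ae_eq_SQ, setIntegral_congr_fun hmeas heq, SQ_eq_Icc]
  refine integral_divergence_prod_Icc_of_hasFDerivAt_of_le f g (fderiv ℝ f) (fderiv ℝ g)
    (0, 0) (1, 1) (by simp [Prod.le_def]) ?_ ?_ ?_ ?_ ?_
  · rw [← SQ_eq_Icc]; exact hf.continuousOn.mono hSW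
  · rw [← SQ_eq_Icc]; exact hg.continuousOn.mono hSW
  · exact fun p hp => (hdf p (SQo_subset_SQ hp)).hasFDerivAt
  · exact fun p hp => (hdg p (SQo_subset_SQ hp)).hasFDerivAt
  · rw [← SQ_eq_Icc]; exact hcont.integrableOn_compact isCompact_SQ

theorem ContinuousOn.horizontal {f : ℝ × ℝ → ℝ} (hf : ContinuousOn f SQ) {y : ℝ}
    (hy : y ∈ Icc (0 : ℝ) 1) : ContinuousOn (fun x => f (x, y)) (Icc (0 : ℝ) 1) :=
  hf.comp (by fun_prop) fun _ hx => ⟨hx, hy⟩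

theorem ContinuousOn.intervalIntegrable_unit {f : ℝ → ℝ} (hf : ContinuousOn f (Icc (0 : ℝ) 1)) :
    IntervalIntegrable f volume 0 1 :=
  ContinuousOn.intervalIntegrable (by rwa [uIcc_of_le zero_le_one])

theorem intervalIntegral_congr_unit {f g : ℝ → ℝ} (h : ∀ x ∈ Icc (0 : ℝ) 1, f x = g x) :
    ∫ x in (0 : ℝ)..1, f x = ∫ x in (0 : ℝ)..1, g x :=
  intervalIntegral.integral_congr fun x hx => h x (by rwa [uIcc_of_le zero_le_one] at hx)

theorem integral_add_sq_unit {f g : ℝ → ℝ} (hf : ContinuousOn f (Icc (0 : ℝ) 1))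
    (hg : ContinuousOn g (Icc (0 : ℝ) 1)) :
    ∫ x in (0 : ℝ)..1, (f x + g x) ^ 2 =
      (∫ x in (0 : ℝ)..1, f x ^ 2) + 2 * (∫ x in (0 : ℝ)..1, f x * g x)
        + ∫ x in (0 : ℝ)..1, g x ^ 2 := by
  have h1 : IntervalIntegrable (fun x => f x ^ 2) volume 0 1 := (hf.pow 2).intervalIntegrable_unit
  have h2 : IntervalIntegrable (fun x => 2 * (f x * g x)) volume 0 1 :=
    ((hf.mul hg).intervalIntegrable_unit).const_mul 2
  have h3 : IntervalIntegrable (fun x => g x ^ 2) volume 0 1 := (hg.pow 2).intervalIntegrable_unit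
  rw [← intervalIntegral.integral_const_mul, ← intervalIntegral.integral_add h1 h2,
    ← intervalIntegral.integral_add (h1.add h2) h3]
  exact intervalIntegral.integral_congr fun x _ => by ring

/-- The weak formulation of the boundary value problem, tested against `(w, W₀, W₁)`. -/
theorem IsCEMSolution.weak_form {σ u w : ℝ × ℝ → ℝ} {U₀ U₁ z₀ z₁ I₀ I₁ : ℝ} {W : Set (ℝ × ℝ)}
    (hsol : IsCEMSolution σ u U₀ U₁ z₀ z₁ I₀ I₁) (hz₀ : 0 < z₀) (hz₁ : 0 < z₁)
    (hW : IsOpen W) (hSW : SQ ⊆ W) (hσ : ContDiffOn ℝ 1 σ W) (hu : ContDiffOn ℝ 2 u W)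
    (hw : ContDiffOn ℝ 1 w W) (W₀ W₁ : ℝ) :
    (∫ p in SQo, σ p * (pdx u p * pdx w p + pdy u p * pdy w p))
      + (1 / z₀) * (∫ x in (0 : ℝ)..1, (u (x, 0) - U₀) * (w (x, 0) - W₀))
      + (1 / z₁) * (∫ x in (0 : ℝ)..1, (u (x, 1) - U₁) * (w (x, 1) - W₁))
      = I₀ * W₀ + I₁ * W₁ := by
  have hux : ContDiffOn ℝ 1 (pdx u) W := hu.pdx hW (by norm_num [one_add_one_eq_two])
  have huy : ContDiffOn ℝ 1 (pdy u) W := hu.pdy hW (by norm_num [one_add_one_eq_two])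
  have hfx : ContDiffOn ℝ 1 (fun q => σ q * pdx u q) W := hσ.mul hux
  have hfy : ContDiffOn ℝ 1 (fun q => σ q * pdy u q) W := hσ.mul huy
  have hdiv := integral_SQo_pdx_add_pdy hW hSW (hw.mul hfx) (hw.mul hfy)
  have hint : ∫ p in SQo, (pdx (fun q => w q * (σ q * pdx u q)) p
      + pdy (fun q => w q * (σ q * pdy u q)) p) =
      ∫ p in SQo, σ p * (pdx u p * pdx w p + pdy u p * pdy w p) := by
    refine setIntegral_congr_fun isOpen_SQo.measurableSet fun p hp => ?_
    have hpW : p ∈ W := hSW (SQo_subset_SQ hp)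
    have hwp := hw.differentiableAt_of_isOpen hW hpW
    rw [pdx_mul hwp (hfx.differentiableAt_of_isOpen hW hpW),
      pdy_mul hwp (hfy.differentiableAt_of_isOpen hW hpW)]
    linear_combination w p * hsol.pde p hp
  have hbot : ∀ x ∈ Icc (0 : ℝ) 1, σ (x, 0) * pdy u (x, 0) = (1 / z₀) * (u (x, 0) - U₀) :=
    fun x hx => by
      have := hsol.robin_bot x hx
      field_simp
      linarith
  have htop : ∀ x ∈ Icc (0 : ℝ) 1, σ (x, 1) * pdy u (x, 1) = -(1 / z₁) * (u (x, 1) - U₁) :=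
    fun x hx => by
      have := hsol.robin_top x hx
      field_simp
      linarith
  have hleft : ∫ y in (0 : ℝ)..1, w (0, y) * (σ (0, y) * pdx u (0, y)) = 0 := by
    rw [intervalIntegral_congr_unit (g := fun _ => 0) fun y hy => by
      rw [hsol.noflux_left y hy]; ring]
    simp
  have hright : ∫ y in (0 : ℝ)..1, w (1, y) * (σ (1, y) * pdx u (1, y)) = 0 := by
    rw [intervalIntegral_congr_unit (g := fun _ => 0) fun y hy => by
      rw [hsol.noflux_right y hy]; ring]
    simp
  have hI₀ : -(1 / z₀) * (∫ x in (0 : ℝ)..1, (u (x, 0) - U₀)) = I₀ := by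
    rw [← hsol.flux_bot, ← intervalIntegral.integral_const_mul]
    exact intervalIntegral_congr_unit fun x hx => by rw [hbot x hx]; ring
  have hI₁ : -(1 / z₁) * (∫ x in (0 : ℝ)..1, (u (x, 1) - U₁)) = I₁ := by
    rw [← hsol.flux_top, ← intervalIntegral.integral_const_mul]
    exact intervalIntegral_congr_unit fun x hx => (htop x hx).symm
  have huS := hu.continuousOn.mono hSW
  have hwS := hw.continuousOn.mono hSW
  have h0 : (0 : ℝ) ∈ Icc (0 : ℝ) 1 := by simp
  have h1 : (1 : ℝ) ∈ Icc (0 : ℝ) 1 := by simp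
  have hsplit : ∀ y ∈ Icc (0 : ℝ) 1, ∀ A B : ℝ,
      ∫ x in (0 : ℝ)..1, (u (x, y) - A) * (w (x, y) - B) =
        (∫ x in (0 : ℝ)..1, (u (x, y) - A) * w (x, y)) - B * ∫ x in (0 : ℝ)..1, (u (x, y) - A) := by
    intro y hy A B
    have hc : ContinuousOn (fun x => u (x, y) - A) (Icc (0 : ℝ) 1) :=
      (huS.horizontal hy).sub continuousOn_const
    have hcw : ContinuousOn (fun x => (u (x, y) - A) * w (x, y)) (Icc (0 : ℝ) 1) :=
      hc.mul (hwS.horizontal hy)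
    rw [← intervalIntegral.integral_const_mul, ← intervalIntegral.integral_sub
      hcw.intervalIntegrable_unit (hc.intervalIntegrable_unit.const_mul B)]
    exact intervalIntegral.integral_congr fun x _ => by ring
  have hgbot : ∫ x in (0 : ℝ)..1, w (x, 0) * (σ (x, 0) * pdy u (x, 0)) =
      (1 / z₀) * ∫ x in (0 : ℝ)..1, (u (x, 0) - U₀) * w (x, 0) := by
    rw [← intervalIntegral.integral_const_mul]
    exact intervalIntegral_congr_unit fun x hx => by rw [hbot x hx]; ring
  have hgtop : ∫ x in (0 : ℝ)..1, w (x, 1) * (σ (x, 1) * pdy u (x, 1)) =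
      -(1 / z₁) * ∫ x in (0 : ℝ)..1, (u (x, 1) - U₁) * w (x, 1) := by
    rw [← intervalIntegral.integral_const_mul]
    exact intervalIntegral_congr_unit fun x hx => by rw [htop x hx]; ring
  have hdiv' := hint.symm.trans hdiv
  simp only [hgbot, hgtop, hleft, hright] at hdiv'
  rw [hdiv', hsplit 0 h0, hsplit 1 h1, ← hI₀, ← hI₁]
  ring

/-- Expansion of the energy of `v` around a solution `u`: the first variation vanishes. -/
theorem IsCEMSolution.Ffun_eq_add {σ u v : ℝ × ℝ → ℝ} {U₀ U₁ z₀ z₁ I₀ I₁ : ℝ} {W : Set (ℝ × ℝ)}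
    (hsol : IsCEMSolution σ u U₀ U₁ z₀ z₁ I₀ I₁) (hz₀ : 0 < z₀) (hz₁ : 0 < z₁)
    (hW : IsOpen W) (hSW : SQ ⊆ W) (hσ : ContDiffOn ℝ 1 σ W) (hu : ContDiffOn ℝ 2 u W)
    (hv : ContDiffOn ℝ 1 v W) (V₀ V₁ : ℝ) :
    Ffun σ z₀ z₁ I₀ I₁ v V₀ V₁ = Ffun σ z₀ z₁ I₀ I₁ u U₀ U₁
      + Ffun σ z₀ z₁ 0 0 (fun q => v q - u q) (V₀ - U₀) (V₁ - U₁) := by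
  have hu1 : ContDiffOn ℝ 1 u W := hu.of_le (by norm_num)
  have hw : ContDiffOn ℝ 1 (fun q => v q - u q) W := hv.sub hu1
  obtain ⟨w, hwdef⟩ : ∃ w, (fun q => v q - u q) = w := ⟨_, rfl⟩
  rw [hwdef] at hw ⊢
  have hweak := hsol.weak_form hz₀ hz₁ hW hSW hσ hu hw (V₀ - U₀) (V₁ - U₁)
  have hv_eq : ∀ q, v q = u q + w q := fun q => by rw [← hwdef]; ring
  have hσS := hσ.continuousOn.mono hSW
  have hux := (hu1.pdx (m := 0) hW (by simp)).continuousOn.mono hSW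
  have huy := (hu1.pdy (m := 0) hW (by simp)).continuousOn.mono hSW
  have hwx := (hw.pdx (m := 0) hW (by simp)).continuousOn.mono hSW
  have hwy := (hw.pdy (m := 0) hW (by simp)).continuousOn.mono hSW
  have huS := hu.continuousOn.mono hSW
  have hwS := hw.continuousOn.mono hSW
  have hbulk : ∫ p in SQo, σ p * ((pdx v p) ^ 2 + (pdy v p) ^ 2) =
      (∫ p in SQo, σ p * ((pdx u p) ^ 2 + (pdy u p) ^ 2))
        + 2 * (∫ p in SQo, σ p * (pdx u p * pdx w p + pdy u p * pdy w p))
        + ∫ p in SQo, σ p * ((pdx w p) ^ 2 + (pdy w p) ^ 2) := by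
    have h1 := (hσS.mul ((hux.pow 2).add (huy.pow 2))).integrableOn_SQo
    have h2 := ((hσS.mul ((hux.mul hwx).add (huy.mul hwy))).integrableOn_SQo).const_mul 2
    have h3 := (hσS.mul ((hwx.pow 2).add (hwy.pow 2))).integrableOn_SQo
    rw [← integral_const_mul]
    refine Eq.trans ?_ ((integral_add (h1.add h2) h3).trans
      (congrArg₂ (· + ·) (integral_add h1 h2) rfl))
    refine setIntegral_congr_fun isOpen_SQo.measurableSet fun p hp => ?_
    have hpW : p ∈ W := hSW (SQo_subset_SQ hp)
    have hdv := hv.differentiableAt_of_isOpen hW hpW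
    have hdu := hu1.differentiableAt_of_isOpen hW hpW
    have hx := pdx_sub hdv hdu
    have hy := pdy_sub hdv hdu
    rw [hwdef] at hx hy
    simp only [Pi.add_apply, Pi.mul_apply, Pi.pow_apply, hx, hy]
    ring
  have hedge : ∀ y ∈ Icc (0 : ℝ) 1, ∀ A B : ℝ, ∫ x in (0 : ℝ)..1, (v (x, y) - B) ^ 2 =
      (∫ x in (0 : ℝ)..1, (u (x, y) - A) ^ 2)
        + 2 * (∫ x in (0 : ℝ)..1, (u (x, y) - A) * (w (x, y) - (B - A)))
        + ∫ x in (0 : ℝ)..1, (w (x, y) - (B - A)) ^ 2 := by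
    intro y hy A B
    rw [← integral_add_sq_unit ((huS.horizontal hy).fun_sub continuousOn_const)
      ((hwS.horizontal hy).fun_sub continuousOn_const)]
    exact intervalIntegral.integral_congr fun x _ => by simp only [hv_eq]; ring
  unfold Ffun
  rw [hbulk, hedge 0 (by simp) U₀ V₀, hedge 1 (by simp) U₁ V₁]
  linear_combination hweak

theorem setIntegral_SQo_energy_nonneg {σ w : ℝ × ℝ → ℝ} (hσpos : ∀ p ∈ SQ, 0 < σ p) :
    0 ≤ ∫ p in SQo, σ p * ((pdx w p) ^ 2 + (pdy w p) ^ 2) :=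
  setIntegral_nonneg isOpen_SQo.measurableSet fun p hp =>
    mul_nonneg (hσpos p (SQo_subset_SQ hp)).le (by positivity)

theorem intervalIntegral_sq_nonneg (f : ℝ → ℝ) : 0 ≤ ∫ x in (0 : ℝ)..1, f x ^ 2 :=
  intervalIntegral.integral_nonneg zero_le_one fun _ _ => sq_nonneg _

theorem Ffun_zero_currents_nonneg {σ w : ℝ × ℝ → ℝ} {z₀ z₁ : ℝ} (hσpos : ∀ p ∈ SQ, 0 < σ p)
    (hz₀ : 0 < z₀) (hz₁ : 0 < z₁) (W₀ W₁ : ℝ) : 0 ≤ Ffun σ z₀ z₁ 0 0 w W₀ W₁ := by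
  have h1 := setIntegral_SQo_energy_nonneg (w := w) hσpos
  have h2 := intervalIntegral_sq_nonneg fun x => w (x, 0) - W₀
  have h3 := intervalIntegral_sq_nonneg fun x => w (x, 1) - W₁
  unfold Ffun
  simp only [zero_mul, sub_zero]
  positivity

theorem eq_zero_of_integral_sq_unit_eq_zero {f : ℝ → ℝ} (hf : ContinuousOn f (Icc (0 : ℝ) 1))
    (h : ∫ x in (0 : ℝ)..1, f x ^ 2 = 0) : ∀ x ∈ Icc (0 : ℝ) 1, f x = 0 := by
  rw [intervalIntegral.integral_of_le zero_le_one, ← integral_Icc_eq_integral_Ioc,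
    setIntegral_eq_zero_iff_of_nonneg_ae (Filter.Eventually.of_forall fun x => sq_nonneg (f x))
      (hf.pow 2).integrableOn_Icc] at h
  have := Measure.eqOn_Icc_of_ae_eq volume zero_ne_one h (hf.pow 2) continuousOn_const
  exact fun x hx => pow_eq_zero_iff two_ne_zero |>.1 (this hx)

theorem eq_const_of_Ffun_zero_currents_eq_zero {σ w : ℝ × ℝ → ℝ} {z₀ z₁ W₀ W₁ : ℝ}
    {W : Set (ℝ × ℝ)} (hσpos : ∀ p ∈ SQ, 0 < σ p) (hz₀ : 0 < z₀) (hz₁ : 0 < z₁)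
    (hW : IsOpen W) (hSW : SQ ⊆ W) (hσ : ContinuousOn σ W) (hw : ContDiffOn ℝ 1 w W)
    (h : Ffun σ z₀ z₁ 0 0 w W₀ W₁ = 0) : (∀ p ∈ SQ, w p = W₀) ∧ W₁ = W₀ := by
  have h1 := setIntegral_SQo_energy_nonneg (w := w) hσpos
  have h2 := intervalIntegral_sq_nonneg fun x => w (x, 0) - W₀
  have h3 := intervalIntegral_sq_nonneg fun x => w (x, 1) - W₁
  unfold Ffun at h
  simp only [zero_mul, sub_zero] at h
  have h2' := mul_nonneg (one_div_pos.2 (mul_pos two_pos hz₀)).le h2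
  have h3' := mul_nonneg (one_div_pos.2 (mul_pos two_pos hz₁)).le h3
  have hbulk : ∫ p in SQo, σ p * ((pdx w p) ^ 2 + (pdy w p) ^ 2) = 0 := by linarith
  have hbot : ∫ x in (0 : ℝ)..1, (w (x, 0) - W₀) ^ 2 = 0 :=
    (mul_eq_zero.1 (by linarith : 1 / (2 * z₀) * _ = 0)).resolve_left (by positivity)
  have htop : ∫ x in (0 : ℝ)..1, (w (x, 1) - W₁) ^ 2 = 0 :=
    (mul_eq_zero.1 (by linarith : 1 / (2 * z₁) * _ = 0)).resolve_left (by positivity)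
  have hwS := hw.continuousOn.mono hSW
  have hwx := (hw.pdx (m := 0) hW (by simp)).continuousOn.mono hSW
  have hwy := (hw.pdy (m := 0) hW (by simp)).continuousOn.mono hSW
  have hbot' := eq_zero_of_integral_sq_unit_eq_zero
    ((hwS.horizontal (y := 0) (by simp)).fun_sub continuousOn_const) hbot
  have htop' := eq_zero_of_integral_sq_unit_eq_zero
    ((hwS.horizontal (y := 1) (by simp)).fun_sub continuousOn_const) htop
  have hcont : ContinuousOn (fun p => σ p * ((pdx w p) ^ 2 + (pdy w p) ^ 2)) SQ :=
    (hσ.mono hSW).mul ((hwx.pow 2).add (hwy.pow 2))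
  rw [setIntegral_congr_set SQo_ae_eq_SQ, setIntegral_eq_zero_iff_of_nonneg_ae
    ((ae_restrict_iff' isCompact_SQ.measurableSet).2 (Filter.Eventually.of_forall fun p hp =>
      mul_nonneg (hσpos p hp).le (by positivity)))
    (hcont.integrableOn_compact isCompact_SQ)] at hbulk
  have hgrad := Measure.eqOn_of_ae_eq hbulk hcont continuousOn_const
    (by rw [← closure_SQo]; exact closure_mono (interior_maximal subset_closure isOpen_SQo))
  have hpdy : ∀ p ∈ SQ, pdy w p = 0 := fun p hp => by
    have := (mul_eq_zero.1 (hgrad hp)).resolve_left (hσpos p hp).ne'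
    nlinarith [sq_nonneg (pdx w p), sq_nonneg (pdy w p)]
  have hconst : ∀ p ∈ SQ, w p = W₀ := by
    rintro ⟨x, y⟩ ⟨hx, hy⟩
    have hd : ∀ t ∈ Icc (0 : ℝ) 1, HasDerivAt (fun s => w (x, s)) 0 t := fun t ht => by
      have hxt : (x, t) ∈ SQ := ⟨hx, ht⟩
      have hdw := hw.differentiableAt_of_isOpen hW (hSW hxt)
      have := hasDerivAt_vertical hdw
      rwa [← pdy_eq_fderiv hdw, hpdy _ hxt] at this
    have := constant_of_has_deriv_right_zero
      (fun t ht => (hd t ht).continuousAt.continuousWithinAt)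
      (fun t ht => (hd t (Ico_subset_Icc_self ht)).hasDerivWithinAt) y hy
    have hb := hbot' x hx
    linarith
  refine ⟨hconst, ?_⟩
  have ht := htop' 0 (by simp)
  have hc := hconst (0, 1) (by simp [SQ])
  linarith

/-- A classical CEM solution is the unique global minimizer of the CEM energy functional
`F_σ` over pairs `(v, V)` with `V₀ + V₁ = 0`. -/
theorem cem_solution_unique_minimizer_F (σ u : ℝ × ℝ → ℝ) (U₀ U₁ z₀ z₁ I₀ I₁ : ℝ)
    (hσ : ∃ W : Set (ℝ × ℝ), IsOpen W ∧ SQ ⊆ W ∧ ContDiffOn ℝ 1 σ W)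
    (hσpos : ∀ p ∈ SQ, 0 < σ p)
    (hz₀ : 0 < z₀) (hz₁ : 0 < z₁) (hI : I₀ + I₁ = 0)
    (hsol : IsCEMSolution σ u U₀ U₁ z₀ z₁ I₀ I₁) :
    ∀ v : ℝ × ℝ → ℝ, C1Nbhd v → ∀ V₀ V₁ : ℝ, V₀ + V₁ = 0 →
      Ffun σ z₀ z₁ I₀ I₁ u U₀ U₁ ≤ Ffun σ z₀ z₁ I₀ I₁ v V₀ V₁ ∧
      (Ffun σ z₀ z₁ I₀ I₁ v V₀ V₁ = Ffun σ z₀ z₁ I₀ I₁ u U₀ U₁ →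
        (∀ p ∈ SQ, v p = u p) ∧ V₀ = U₀ ∧ V₁ = U₁) := by
  obtain ⟨A, hA, hSA, hσA⟩ := hσ
  obtain ⟨B, hB, hSB, huB⟩ := hsol.smooth
  rintro v ⟨C, hC, hSC, hvC⟩ V₀ V₁ hV
  have hW : IsOpen (A ∩ B ∩ C) := (hA.inter hB).inter hC
  have hSW : SQ ⊆ A ∩ B ∩ C := subset_inter (subset_inter hSA hSB) hSC
  have hσW := hσA.mono (fun p (hp : p ∈ A ∩ B ∩ C) => hp.1.1)
  have huW := huB.mono (fun p (hp : p ∈ A ∩ B ∩ C) => hp.1.2)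
  have hvW := hvC.mono (fun p (hp : p ∈ A ∩ B ∩ C) => hp.2)
  have hF := hsol.Ffun_eq_add hz₀ hz₁ hW hSW hσW huW hvW V₀ V₁
  refine ⟨?_, fun heq => ?_⟩
  · have := Ffun_zero_currents_nonneg (w := fun q => v q - u q) hσpos hz₀ hz₁ (V₀ - U₀) (V₁ - U₁)
    linarith
  · obtain ⟨hc, hc'⟩ := eq_const_of_Ffun_zero_currents_eq_zero hσpos hz₀ hz₁ hW hSW
      hσW.continuousOn (hvW.sub (huW.of_le (by norm_num))) (by linarith)
    have hU := hsol.ground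
    have hV₀ : V₀ = U₀ := by linarith
    refine ⟨fun p hp => ?_, hV₀, by linarith⟩
    have := hc p hp
    linarith
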